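/- Let n ≥ 2 be an integer, let Ω ⊂ ℝⁿ be a bounded open set with smooth boundary, and let λ be a real number. Suppose u₁ is a smooth function on Ω with u₁ > 0 on Ω and Δu₁ + λu₁ = 0 on Ω. Let A be a continuous function on the closure of Ω and let v be a C² function on a neighborhood of the closure of Ω such that: (i) Δv + A·v ≤ 0 on Ω; (ii) v = 0 on ∂Ω; (iii) ∂v/∂ν = 0 on ∂Ω, where ν is the outward unit normal; (iv) A(x) < λ at every x ∈ Ω with v(x) ≤ 0; (v) the quotient v/u₁ extends to a continuous function on the closure of Ω vanishing on ∂Ω. Then v ≡ 0 on Ω. -/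

import Mathlib

open MeasureTheory Real

/-- The Euclidean Laplacian of a function `u : ℝⁿ → ℝ`. -/
noncomputable def lap {n : ℕ} (u : EuclideanSpace ℝ (Fin n) → ℝ)
    (x : EuclideanSpace ℝ (Fin n)) : ℝ :=
  ∑ i : Fin n, fderiv ℝ (fun y => fderiv ℝ u y (EuclideanSpace.single i 1)) x
    (EuclideanSpace.single i 1)

/-- `Ω` has smooth boundary, with outward unit normal field `ν` on `∂Ω`:
there is a smooth defining function `f` with `Ω = {f < 0}`, `∂Ω = {f = 0}`,
`∇f ≠ 0` on `∂Ω`, and `ν = ∇f/‖∇f‖` on `∂Ω`. -/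
def SmoothBoundaryNormal {n : ℕ} (Ω : Set (EuclideanSpace ℝ (Fin n)))
    (ν : EuclideanSpace ℝ (Fin n) → EuclideanSpace ℝ (Fin n)) : Prop :=
  ∃ f : EuclideanSpace ℝ (Fin n) → ℝ, ContDiff ℝ (⊤ : ℕ∞) f ∧
    Ω = {x | f x < 0} ∧ frontier Ω = {x | f x = 0} ∧
    ∀ x ∈ frontier Ω, gradient f x ≠ 0 ∧ ν x = ‖gradient f x‖⁻¹ • gradient f x

open Filter Topology Metric Set

theorem IsLocalMin.deriv_deriv_nonneg {g : ℝ → ℝ} {a : ℝ} (hg : IsLocalMin g a)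
    (hc : ContinuousAt g a) : 0 ≤ deriv (deriv g) a := by
  by_contra! hneg
  have hmax : IsLocalMax g a := isLocalMax_of_deriv_deriv_neg hneg hg.deriv_eq_zero hc
  have hconst : g =ᶠ[𝓝 a] fun _ => g a := by
    filter_upwards [hg, hmax] with t h₁ h₂ using le_antisymm h₂ h₁
  have hzero : deriv (deriv g) a = 0 := by
    rw [hconst.deriv.deriv_eq]
    simp
  exact hneg.ne hzero

theorem IsLocalMin.fderiv_fderiv_nonneg {E : Type*} [NormedAddCommGroup E] [NormedSpace ℝ E]
    {w : E → ℝ} {z : E} (hw : IsLocalMin w z) (hd : ContDiffAt ℝ 2 w z) (e : E) :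
    0 ≤ fderiv ℝ (fun y => fderiv ℝ w y e) z e := by
  have hline (t : ℝ) : HasDerivAt (fun t : ℝ => z + t • e) e t := by
    simpa using ((hasDerivAt_id t).smul_const e).const_add z
  have hz : z + (0 : ℝ) • e = z := by simp
  have htend : Tendsto (fun t : ℝ => z + t • e) (𝓝 0) (𝓝 z) := by
    simpa only [hz] using (hline 0).continuousAt.tendsto
  have hder : deriv (fun t : ℝ => w (z + t • e)) =ᶠ[𝓝 0]
      fun t => fderiv ℝ w (z + t • e) e := by
    filter_upwards [htend.eventually (hd.eventually (by simp))] with t ht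
    exact ((ht.differentiableAt (by simp)).hasFDerivAt.comp_hasDerivAt t (hline t)).deriv
  have hdd : DifferentiableAt ℝ (fun y => fderiv ℝ w y e) (z + (0 : ℝ) • e) := by
    rw [hz]
    exact ((hd.fderiv_right (m := 1) (by norm_num)).differentiableAt (by simp)).clm_apply
      (differentiableAt_const e)
  have hsecond : deriv (deriv fun t : ℝ => w (z + t • e)) 0 =
      fderiv ℝ (fun y => fderiv ℝ w y e) z e := by
    rw [hder.deriv_eq]
    simpa only [hz, Function.comp_def] using
      (hdd.hasFDerivAt.comp_hasDerivAt (0 : ℝ) (hline 0)).deriv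
  rw [← hsecond]
  apply IsLocalMin.deriv_deriv_nonneg
  · filter_upwards [htend.eventually hw] with t ht
    simpa using ht
  · refine ContinuousAt.comp (f := fun t : ℝ => z + t • e) (g := w) ?_ (hline 0).continuousAt
    rw [hz]
    exact hd.continuousAt

theorem IsLocalMin.lap_nonneg {n : ℕ} {w : EuclideanSpace ℝ (Fin n) → ℝ}
    {z : EuclideanSpace ℝ (Fin n)} (hw : IsLocalMin w z) (hd : ContDiffAt ℝ 2 w z) :
    0 ≤ lap w z :=
  Finset.sum_nonneg fun _ _ => hw.fderiv_fderiv_nonneg hd _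

theorem lap_sub_const_mul {n : ℕ} {u w : EuclideanSpace ℝ (Fin n) → ℝ}
    {x : EuclideanSpace ℝ (Fin n)} (hu : ContDiffAt ℝ 2 u x) (hw : ContDiffAt ℝ 2 w x) (c : ℝ) :
    lap (fun y => u y - c * w y) x = lap u x - c * lap w x := by
  simp only [lap, Finset.mul_sum, ← Finset.sum_sub_distrib]
  refine Finset.sum_congr rfl fun i _ => ?_
  set e : EuclideanSpace ℝ (Fin n) := EuclideanSpace.single i 1
  have hfirst : (fun y => fderiv ℝ (fun y => u y - c * w y) y e) =ᶠ[𝓝 x]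
      fun y => fderiv ℝ u y e - c * fderiv ℝ w y e := by
    filter_upwards [hu.eventually (by simp), hw.eventually (by simp)] with y hy hy'
    have h₁ := (hy.differentiableAt (by simp)).hasFDerivAt
    have h₂ := (hy'.differentiableAt (by simp)).hasFDerivAt
    rw [(h₁.fun_sub (h₂.const_mul c)).fderiv]
    simp
  have hdiff {g : EuclideanSpace ℝ (Fin n) → ℝ} (hg : ContDiffAt ℝ 2 g x) :
      HasFDerivAt (fun y => fderiv ℝ g y e) (fderiv ℝ (fun y => fderiv ℝ g y e) x) x :=
    (((hg.fderiv_right (m := 1) (by norm_num)).differentiableAt (by simp)).clm_apply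
      (differentiableAt_const e)).hasFDerivAt
  rw [hfirst.fderiv_eq, ((hdiff hu).fun_sub ((hdiff hw).const_mul c)).fderiv]
  simp

theorem hasFDerivAt_exp_neg_mul_norm_sq {E : Type*} [NormedAddCommGroup E]
    [InnerProductSpace ℝ E] (a : ℝ) (c x : E) :
    HasFDerivAt (fun y => exp (-a * ‖y - c‖ ^ 2))
      ((-2 * a * exp (-a * ‖x - c‖ ^ 2)) • innerSL ℝ (x - c)) x := by
  have h := ((((hasFDerivAt_id x).sub_const c).norm_sq).const_mul (-a)).exp
  refine h.congr_fderiv ?_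
  ext d
  simp
  ring

theorem lap_exp_neg_mul_norm_sq {n : ℕ} (a b : ℝ) (c x : EuclideanSpace ℝ (Fin n)) :
    lap (fun y => exp (-a * ‖y - c‖ ^ 2) - b) x =
      (4 * a ^ 2 * ‖x - c‖ ^ 2 - 2 * n * a) * exp (-a * ‖x - c‖ ^ 2) := by
  have hterm (i : Fin n) :
      fderiv ℝ (fun y => fderiv ℝ (fun y => exp (-a * ‖y - c‖ ^ 2) - b) y
        (EuclideanSpace.single i 1)) x (EuclideanSpace.single i 1) =
      (4 * a ^ 2 * (x - c) i ^ 2 - 2 * a) * exp (-a * ‖x - c‖ ^ 2) := by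
    have hfirst : (fun y => fderiv ℝ (fun y => exp (-a * ‖y - c‖ ^ 2) - b) y
        (EuclideanSpace.single i 1)) =
        fun y => (-2 * a * exp (-a * ‖y - c‖ ^ 2)) * inner ℝ (EuclideanSpace.single i 1) (y - c) := by
      funext y
      rw [((hasFDerivAt_exp_neg_mul_norm_sq a c y).sub_const b).fderiv]
      rw [smul_apply, innerSL_apply_apply, smul_eq_mul, real_inner_comm]
    have hinner : HasFDerivAt (fun y : EuclideanSpace ℝ (Fin n) =>
        inner ℝ (EuclideanSpace.single i (1 : ℝ)) (y - c))
        (innerSL ℝ (EuclideanSpace.single i (1 : ℝ))) x :=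
      (innerSL ℝ (EuclideanSpace.single i (1 : ℝ))).hasFDerivAt.comp x
        ((hasFDerivAt_id x).sub_const c)
    rw [hfirst, (((hasFDerivAt_exp_neg_mul_norm_sq a c x).const_mul (-2 * a)).fun_mul hinner).fderiv]
    have hcoord (z : EuclideanSpace ℝ (Fin n)) :
        inner ℝ (EuclideanSpace.single i (1 : ℝ)) z = z i := by
      simp [EuclideanSpace.inner_single_left]
    simp only [add_apply, smul_apply, innerSL_apply_apply, smul_eq_mul,
      real_inner_comm (EuclideanSpace.single i (1 : ℝ)) (x - c), hcoord,
      PiLp.single_apply, if_true]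
    ring
  simp only [lap, hterm]
  rw [← Finset.sum_mul, Finset.sum_sub_distrib, ← Finset.mul_sum, EuclideanSpace.real_norm_sq_eq]
  simp
  ring

theorem HasFDerivAt.nonneg_of_eventually_nonneg {E : Type*} [NormedAddCommGroup E]
    [NormedSpace ℝ E] {g : E → ℝ} {L : E →L[ℝ] ℝ} {y d : E} (hg : HasFDerivAt g L y)
    (hy : g y = 0) (hd : ∀ᶠ t : ℝ in 𝓝[>] 0, 0 ≤ g (y + t • d)) : 0 ≤ L d := by
  have hline : HasDerivAt (fun t : ℝ => y + t • d) d 0 := by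
    simpa using ((hasDerivAt_id (0 : ℝ)).smul_const d).const_add y
  have hz : y + (0 : ℝ) • d = y := by simp
  have hcomp : HasDerivAt (fun t : ℝ => g (y + t • d)) (L d) 0 :=
    HasFDerivAt.comp_hasDerivAt (0 : ℝ) (by rwa [hz]) hline
  have hslope := hcomp.tendsto_slope.mono_left (nhdsWithin_mono 0 fun t (ht : t ∈ Ioi 0) => ne_of_gt ht)
  refine ge_of_tendsto hslope ?_
  filter_upwards [hd, self_mem_nhdsWithin] with t ht ht'
  have ht'' : (0 : ℝ) < t := ht'
  rw [slope_def_field, hz, hy]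
  simp only [sub_zero]
  positivity

/-- The Hopf boundary point lemma on a ball for supersolutions of `Δ - M`. -/
theorem hopf_fderiv_pos {n : ℕ} {v : EuclideanSpace ℝ (Fin n) → ℝ}
    {x₀ y₀ : EuclideanSpace ℝ (Fin n)} {R M : ℝ} (hR : 0 < R) (hM : 0 ≤ M)
    (hy₀ : ‖y₀ - x₀‖ = R) (hc : ContinuousOn v (closedBall x₀ R))
    (hd : ∀ x ∈ ball x₀ R, ContDiffAt ℝ 2 v x) (hpos : ∀ x ∈ ball x₀ R, 0 < v x)
    (hnonneg : ∀ x ∈ closedBall x₀ R, 0 ≤ v x) (hlap : ∀ x ∈ ball x₀ R, lap v x ≤ M * v x)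
    (hvy : v y₀ = 0) (hvd : DifferentiableAt ℝ v y₀) : 0 < fderiv ℝ v y₀ (x₀ - y₀) := by
  obtain ⟨a, ha1, haR⟩ : ∃ a : ℝ, 1 ≤ a ∧ (2 * n + M + 1) ≤ a * R ^ 2 := by
    refine ⟨(2 * n + M + 1) / R ^ 2 + 1, ?_, ?_⟩
    · have : 0 ≤ (2 * n + M + 1) / R ^ 2 := by positivity
      linarith
    · rw [add_mul, div_mul_cancel₀ _ (by positivity)]
      nlinarith [sq_nonneg R]
  set b : ℝ := exp (-a * R ^ 2) with hb
  set h : EuclideanSpace ℝ (Fin n) → ℝ := fun y => exp (-a * ‖y - x₀‖ ^ 2) - b with hh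
  have hhd : ContDiff ℝ 2 h := by
    have : ContDiff ℝ 2 fun y : EuclideanSpace ℝ (Fin n) => ‖y - x₀‖ ^ 2 :=
      (contDiff_id.sub contDiff_const).norm_sq ℝ
    exact (contDiff_const.mul this).exp.sub contDiff_const
  have hbpos : 0 < b := exp_pos _
  have hhle (x) : h x ≤ 1 := by
    have : exp (-a * ‖x - x₀‖ ^ 2) ≤ 1 := by
      rw [exp_le_one_iff]
      nlinarith [sq_nonneg ‖x - x₀‖]
    simp only [hh]
    linarith
  have hhlap (x) (hx : R / 2 ≤ ‖x - x₀‖) : M * h x < lap h x := by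
    rw [hh, lap_exp_neg_mul_norm_sq]
    have hE : 0 < exp (-a * ‖x - x₀‖ ^ 2) := exp_pos _
    have hsq : R ^ 2 ≤ 4 * ‖x - x₀‖ ^ 2 := by nlinarith
    have h₁ : a ^ 2 * R ^ 2 ≤ a ^ 2 * (4 * ‖x - x₀‖ ^ 2) := by gcongr
    have h₂ : a * (2 * n + M + 1) ≤ a * (a * R ^ 2) := by gcongr
    have h₃ : M < 4 * a ^ 2 * ‖x - x₀‖ ^ 2 - 2 * n * a := by nlinarith
    have h₄ := mul_lt_mul_of_pos_right h₃ hE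
    have h₅ : 0 ≤ M * b := by positivity
    simp only [mul_sub]
    linarith
  obtain ⟨ε, hε, hεv⟩ : ∃ ε > 0, ∀ x ∈ closedBall x₀ (R / 2), ε ≤ v x := by
    have hsub : closedBall x₀ (R / 2) ⊆ ball x₀ R := closedBall_subset_ball (by linarith)
    obtain ⟨z, hz, hzmin⟩ := (isCompact_closedBall x₀ (R / 2)).exists_isMinOn
      ⟨x₀, mem_closedBall_self (by linarith)⟩ (hc.mono (hsub.trans ball_subset_closedBall))
    exact ⟨v z, hpos z (hsub hz), fun x hx => hzmin hx⟩
  set K := closedBall x₀ R \ ball x₀ (R / 2) with hK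
  set w : EuclideanSpace ℝ (Fin n) → ℝ := fun y => v y - ε * h y with hw
  have hKw : ∀ x ∈ K, 0 ≤ w x := by
    have hKc : IsCompact K := (isCompact_closedBall x₀ R).diff isOpen_ball
    have hyK : y₀ ∈ K := by
      simp only [hK, Set.mem_sdiff, mem_closedBall, mem_ball, dist_eq_norm, hy₀]
      constructor <;> linarith
    have hwc : ContinuousOn w K :=
      (hc.mono sdiff_subset).sub (continuousOn_const.mul hhd.continuous.continuousOn)
    obtain ⟨z, hzK, hz⟩ := hKc.exists_isMinOn ⟨y₀, hyK⟩ hwc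
    suffices 0 ≤ w z from fun x hx => this.trans (hz hx)
    by_contra! hneg
    have hzK' := hzK
    simp only [hK, Set.mem_sdiff, mem_closedBall, mem_ball, dist_eq_norm, not_lt] at hzK'
    have hzR : ‖z - x₀‖ < R := by
      refine lt_of_le_of_ne hzK'.1 fun heq => ?_
      have : h z = 0 := by simp [hh, heq, hb]
      have hvz := hnonneg z hzK.1
      simp only [hw, this] at hneg
      linarith
    have hzR' : R / 2 < ‖z - x₀‖ := by
      refine lt_of_le_of_ne hzK'.2 fun heq => ?_
      have hvz := hεv z (by simp [dist_eq_norm, ← heq])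
      simp only [hw] at hneg
      nlinarith [hhle z]
    have hzball : z ∈ ball x₀ R := by simpa [dist_eq_norm] using hzR
    have hKn : K ∈ 𝓝 z := by
      refine Filter.mem_of_superset ((isOpen_ball.sdiff isClosed_closedBall).mem_nhds
        (⟨hzball, by simpa [dist_eq_norm] using hzR'⟩ : z ∈ ball x₀ R \ closedBall x₀ (R / 2))) ?_
      exact sdiff_subset_sdiff ball_subset_closedBall ball_subset_closedBall
    have hwd : ContDiffAt ℝ 2 w z :=
      (hd z hzball).sub (contDiffAt_const.mul hhd.contDiffAt)
    have hwlap := (hz.isLocalMin hKn).lap_nonneg hwd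
    rw [hw, lap_sub_const_mul (hd z hzball) hhd.contDiffAt] at hwlap
    have h₁ := hlap z hzball
    have h₂ := mul_lt_mul_of_pos_left (hhlap z hzR'.le) hε
    have h₃ : M * (v z - ε * h z) ≤ 0 := mul_nonpos_of_nonneg_of_nonpos hM hneg.le
    nlinarith
  have hhy : HasFDerivAt h ((-2 * a * b) • innerSL ℝ (y₀ - x₀)) y₀ := by
    have := (hasFDerivAt_exp_neg_mul_norm_sq a x₀ y₀).sub_const b
    rwa [hy₀] at this
  have hwy : w y₀ = 0 := by simp [hw, hh, hvy, hy₀, hb]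
  have key := (hvd.hasFDerivAt.sub (hhy.const_mul ε)).nonneg_of_eventually_nonneg
    (d := x₀ - y₀) hwy (by
      filter_upwards [Ioo_mem_nhdsGT (show (0 : ℝ) < 1 / 2 by norm_num)] with t ht
      apply hKw
      have : y₀ + t • (x₀ - y₀) - x₀ = (1 - t) • (y₀ - x₀) := by module
      simp only [hK, Set.mem_sdiff, mem_closedBall, mem_ball, dist_eq_norm, this, norm_smul, hy₀,
        Real.norm_eq_abs, abs_of_pos (show 0 < 1 - t by linarith [ht.2])]
      constructor <;> nlinarith [ht.1, ht.2])
  have hin : inner ℝ (y₀ - x₀) (x₀ - y₀) = - R ^ 2 := by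
    rw [← neg_sub y₀ x₀, inner_neg_right, real_inner_self_eq_norm_sq, hy₀]
  simp only [sub_apply, smul_apply, innerSL_apply_apply,
    hin, smul_eq_mul] at key
  have : 0 < ε * (a * b * R ^ 2) := by positivity
  nlinarith

/-- A nonzero vector whose inner products are nonpositive on the open half-space `{d | 0 < ⟪d, p⟫}`
is a negative multiple of `p`. -/
theorem exists_neg_smul_of_inner_nonpos {E : Type*} [NormedAddCommGroup E]
    [InnerProductSpace ℝ E] {p q : E} (hp : p ≠ 0) (hq : q ≠ 0)
    (h : ∀ d : E, 0 < inner ℝ d p → inner ℝ q d ≤ 0) : ∃ c : ℝ, c < 0 ∧ q = c • p := by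
  have hpp : 0 < ‖p‖ ^ 2 := by positivity
  set c := inner ℝ q p / ‖p‖ ^ 2 with hc
  have hcp : c * ‖p‖ ^ 2 = inner ℝ q p := by rw [hc, div_mul_cancel₀ _ hpp.ne']
  have horth : inner ℝ (q - c • p) p = 0 := by
    rw [inner_sub_left, real_inner_smul_left, real_inner_self_eq_norm_sq, hcp, sub_self]
  have hle : ∀ s > 0, ‖q - c • p‖ ^ 2 + s * inner ℝ q p ≤ 0 := by
    intro s hs
    have h₁ := h ((q - c • p) + s • p) (by
      rw [inner_add_left, horth, real_inner_smul_left, real_inner_self_eq_norm_sq]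
      positivity)
    have h₂ : inner ℝ q (q - c • p) = ‖q - c • p‖ ^ 2 := by
      nth_rewrite 1 [show q = (q - c • p) + c • p by module]
      rw [inner_add_left, real_inner_smul_left, real_inner_comm (q - c • p) p, horth,
        real_inner_self_eq_norm_sq]
      simp
    rwa [inner_add_right, h₂, real_inner_smul_right] at h₁
  have hzero : ‖q - c • p‖ ^ 2 ≤ 0 := by
    have ht : Tendsto (fun s : ℝ => ‖q - c • p‖ ^ 2 + s * inner ℝ q p) (𝓝[>] 0)
        (𝓝 (‖q - c • p‖ ^ 2 + 0 * inner ℝ q p)) :=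
      ((continuous_const.add (continuous_id.mul continuous_const)).tendsto 0).mono_left
        nhdsWithin_le_nhds
    have := le_of_tendsto ht (eventually_nhdsWithin_of_forall hle)
    simpa using this
  have hqc : q = c • p := by
    have : ‖q - c • p‖ = 0 := by nlinarith [norm_nonneg (q - c • p)]
    exact sub_eq_zero.mp (norm_eq_zero.mp this)
  refine ⟨c, lt_of_le_of_ne ?_ ?_, hqc⟩
  · have := h p (by rwa [real_inner_self_eq_norm_sq])
    by_contra! hcpos
    nlinarith
  · intro h0
    exact hq (by rw [hqc, h0, zero_smul])

theorem gradient_eq_neg_smul_of_neg_on_ball {E : Type*} [NormedAddCommGroup E]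
    [InnerProductSpace ℝ E] [CompleteSpace E] {f : E → ℝ} {x₀ y₀ : E} {R : ℝ} (hR : 0 < R)
    (hy₀ : ‖y₀ - x₀‖ = R) (hf : DifferentiableAt ℝ f y₀) (hfy : f y₀ = 0)
    (hneg : ∀ x ∈ ball x₀ R, f x < 0) (hgrad : gradient f y₀ ≠ 0) :
    ∃ c : ℝ, c < 0 ∧ gradient f y₀ = c • (x₀ - y₀) := by
  have hnorm : ‖x₀ - y₀‖ = R := by rw [norm_sub_rev, hy₀]
  refine exists_neg_smul_of_inner_nonpos (norm_pos_iff.mp (hnorm ▸ hR)) hgrad fun d hd => ?_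
  have hinner : inner ℝ (gradient f y₀) d = fderiv ℝ f y₀ d := by
    simp [gradient]
  rw [hinner]
  have key := hf.hasFDerivAt.neg.nonneg_of_eventually_nonneg (d := d) (by simp [hfy]) (by
    have ht : Tendsto (fun t : ℝ => t * ‖d‖ ^ 2) (𝓝[>] 0) (𝓝 (0 * ‖d‖ ^ 2)) :=
      ((continuous_id.mul continuous_const).tendsto 0).mono_left nhdsWithin_le_nhds
    rw [zero_mul] at ht
    filter_upwards [ht.eventually (gt_mem_nhds hd), self_mem_nhdsWithin] with t ht ht0
    have ht0' : (0 : ℝ) < t := ht0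
    have hball : y₀ + t • d ∈ ball x₀ R := by
      rw [mem_ball, dist_eq_norm, show y₀ + t • d - x₀ = t • d - (x₀ - y₀) by module]
      refine lt_of_pow_lt_pow_left₀ 2 hR.le ?_
      rw [norm_sub_sq_real, norm_smul, hnorm, real_inner_smul_left, mul_pow, Real.norm_eq_abs,
        sq_abs]
      nlinarith
    have := hneg _ hball
    simp only [Pi.neg_apply]
    linarith)
  simpa using key

/-- Ground-state maximum principle. -/
theorem nonneg_of_ground_state {n : ℕ} {Ω : Set (EuclideanSpace ℝ (Fin n))} (hΩo : IsOpen Ω)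
    (hΩb : Bornology.IsBounded Ω) {lam : ℝ} {u A v β : EuclideanSpace ℝ (Fin n) → ℝ}
    (hu : ∀ x ∈ Ω, ContDiffAt ℝ 2 u x) (hupos : ∀ x ∈ Ω, 0 < u x)
    (hueq : ∀ x ∈ Ω, lap u x + lam * u x = 0) (hv : ∀ x ∈ Ω, ContDiffAt ℝ 2 v x)
    (hineq : ∀ x ∈ Ω, lap v x + A x * v x ≤ 0) (hAlt : ∀ x ∈ Ω, v x ≤ 0 → A x < lam)
    (hβc : ContinuousOn β (closure Ω)) (hβeq : ∀ x ∈ Ω, v x = u x * β x)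
    (hβbd : ∀ x ∈ frontier Ω, β x = 0) : ∀ x ∈ Ω, 0 ≤ v x := by
  intro x hx
  obtain ⟨z, hz, hzmin⟩ := hΩb.isCompact_closure.exists_isMinOn ⟨x, subset_closure hx⟩ hβc
  suffices 0 ≤ β z by
    rw [hβeq x hx]
    exact mul_nonneg (hupos x hx).le (this.trans (hzmin (subset_closure hx)))
  by_contra! hneg
  have hzΩ : z ∈ Ω := by
    by_contra hzn
    exact hneg.ne (hβbd z (by rw [hΩo.frontier_eq]; exact ⟨hz, hzn⟩))
  have hmin : IsLocalMin (fun y => v y - β z * u y) z := by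
    filter_upwards [hΩo.mem_nhds hzΩ] with y hy
    have h₁ : β z ≤ β y := hzmin (subset_closure hy)
    rw [hβeq z hzΩ, hβeq y hy]
    nlinarith [hupos y hy]
  have hlap := hmin.lap_nonneg ((hv z hzΩ).sub (contDiffAt_const.mul (hu z hzΩ)))
  rw [lap_sub_const_mul (hv z hzΩ) (hu z hzΩ)] at hlap
  have hvz : v z < 0 := by
    rw [hβeq z hzΩ]
    exact mul_neg_of_pos_of_neg (hupos z hzΩ) hneg
  have h₁ := hineq z hzΩ
  have h₂ := mul_pos_of_neg_of_neg (sub_neg.mpr (hAlt z hzΩ hvz.le)) hvz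
  have h₃ : lap u z = -(lam * u z) := by linarith [hueq z hzΩ]
  have h₄ : β z * lap u z = -(lam * v z) := by rw [h₃, hβeq z hzΩ]; ring
  linarith

/-- Combination of the ground-state maximum principle and the Hopf boundary point
lemma: under the hypotheses of the ground-state maximum principle together with
`∂v/∂ν = 0` on `∂Ω`, the function `v` vanishes identically on `Ω`. -/
theorem stmt_8 (n : ℕ) (hn : 2 ≤ n)
    (Ω : Set (EuclideanSpace ℝ (Fin n))) (hΩo : IsOpen Ω)
    (hΩb : Bornology.IsBounded Ω)
    (ν : EuclideanSpace ℝ (Fin n) → EuclideanSpace ℝ (Fin n))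
    (hsb : SmoothBoundaryNormal Ω ν) (lam : ℝ)
    (u₁ : EuclideanSpace ℝ (Fin n) → ℝ)
    (hu₁ : ContDiffOn ℝ (⊤ : ℕ∞) u₁ Ω)
    (hu₁pos : ∀ x ∈ Ω, 0 < u₁ x)
    (hu₁eq : ∀ x ∈ Ω, lap u₁ x + lam * u₁ x = 0)
    (A : EuclideanSpace ℝ (Fin n) → ℝ) (hA : ContinuousOn A (closure Ω))
    (v : EuclideanSpace ℝ (Fin n) → ℝ)
    (V : Set (EuclideanSpace ℝ (Fin n)))
    (hV : IsOpen V) (hVc : closure Ω ⊆ V)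
    (hv : ContDiffOn ℝ 2 v V)
    (hineq : ∀ x ∈ Ω, lap v x + A x * v x ≤ 0)
    (hbd : ∀ x ∈ frontier Ω, v x = 0)
    (hbd' : ∀ x ∈ frontier Ω, fderiv ℝ v x (ν x) = 0)
    (hAlt : ∀ x ∈ Ω, v x ≤ 0 → A x < lam)
    (β : EuclideanSpace ℝ (Fin n) → ℝ)
    (hβc : ContinuousOn β (closure Ω))
    (hβeq : ∀ x ∈ Ω, v x = u₁ x * β x)
    (hβbd : ∀ x ∈ frontier Ω, β x = 0) :
    ∀ x ∈ Ω, v x = 0 := by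
  obtain ⟨f, hf, hΩf, hfront, hgrad⟩ := hsb
  have hvat : ∀ x ∈ closure Ω, ContDiffAt ℝ 2 v x := fun x hx =>
    hv.contDiffAt (hV.mem_nhds (hVc hx))
  have hnonneg : ∀ x ∈ Ω, 0 ≤ v x :=
    nonneg_of_ground_state hΩo hΩb
      (fun x hx => (hu₁.contDiffAt (hΩo.mem_nhds hx)).of_le (by norm_cast))
      hu₁pos hu₁eq (fun x hx => hvat x (subset_closure hx)) hineq hAlt hβc hβeq hβbd
  have hnonneg' : ∀ x ∈ closure Ω, 0 ≤ v x := by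
    intro x hx
    by_cases hxΩ : x ∈ Ω
    · exact hnonneg x hxΩ
    · exact (hbd x (by rw [hΩo.frontier_eq]; exact ⟨hx, hxΩ⟩)).ge
  obtain ⟨M, hM⟩ := hΩb.isCompact_closure.exists_bound_of_continuousOn hA
  intro x₀ hx₀
  by_contra hne
  set U : Set (EuclideanSpace ℝ (Fin n)) := Ω ∩ v ⁻¹' Ioi 0
  have hvcont : ContinuousOn v (closure Ω) := fun x hx => (hvat x hx).continuousAt.continuousWithinAt
  have hUo : IsOpen U := (hvcont.mono subset_closure).isOpen_inter_preimage hΩo isOpen_Ioi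
  have hx₀U : x₀ ∈ U := ⟨hx₀, lt_of_le_of_ne (hnonneg x₀ hx₀) (Ne.symm hne)⟩
  have hM0 : 0 ≤ M := (norm_nonneg _).trans (hM x₀ (subset_closure hx₀))
  have hUne : Uᶜ.Nonempty := by
    rw [nonempty_compl]
    intro huniv
    have : Nonempty (Fin n) := ⟨⟨0, by omega⟩⟩
    exact NormedSpace.unbounded_univ ℝ (EuclideanSpace ℝ (Fin n))
      (huniv ▸ hΩb.subset inter_subset_left)
  obtain ⟨y₀, hy₀U, hy₀⟩ := hUo.isClosed_compl.exists_infDist_eq_dist hUne x₀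
  set R := dist x₀ y₀ with hRdef
  have hR : 0 < R := dist_pos.mpr fun heq => hy₀U (heq ▸ hx₀U)
  have hballU : ball x₀ R ⊆ U := by
    intro x hx
    by_contra hxU
    have := infDist_le_dist_of_mem (x := x₀) (show x ∈ Uᶜ from hxU)
    rw [mem_ball, dist_comm] at hx
    linarith
  have hclosed : closedBall x₀ R ⊆ closure Ω := by
    rw [← closure_ball x₀ hR.ne']
    exact closure_mono (hballU.trans inter_subset_left)
  have hynorm : ‖y₀ - x₀‖ = R := by rw [hRdef, dist_comm, dist_eq_norm]
  have hyΩ : y₀ ∈ closure Ω := hclosed (by simp [dist_eq_norm, hynorm])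
  have hvy : v y₀ = 0 := by
    by_cases hyin : y₀ ∈ Ω
    · exact le_antisymm (not_lt.mp fun hlt => hy₀U ⟨hyin, hlt⟩) (hnonneg y₀ hyin)
    · exact hbd y₀ (by rw [hΩo.frontier_eq]; exact ⟨hyΩ, hyin⟩)
  have hopf : 0 < fderiv ℝ v y₀ (x₀ - y₀) := by
    refine hopf_fderiv_pos hR hM0 hynorm (hvcont.mono hclosed)
      (fun x hx => hvat x (subset_closure (hballU hx).1)) (fun x hx => (hballU hx).2)
      (fun x hx => hnonneg' x (hclosed hx)) (fun x hx => ?_) hvy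
      ((hvat y₀ hyΩ).differentiableAt (by simp))
    obtain ⟨hxΩ, hxpos⟩ := hballU hx
    have h₁ : -M ≤ A x := (abs_le.mp (hM x (subset_closure hxΩ))).1
    have h₂ := mul_le_mul_of_nonneg_right h₁ (hnonneg x hxΩ)
    linarith [hineq x hxΩ]
  by_cases hyin : y₀ ∈ Ω
  · have hmin : IsLocalMin v y₀ := by
      filter_upwards [hΩo.mem_nhds hyin] with y hy
      rw [hvy]
      exact hnonneg y hy
    rw [hmin.fderiv_eq_zero] at hopf
    simp at hopf
  · have hyfront : y₀ ∈ frontier Ω := by rw [hΩo.frontier_eq]; exact ⟨hyΩ, hyin⟩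
    obtain ⟨hgne, hνy⟩ := hgrad y₀ hyfront
    obtain ⟨c, hc, hceq⟩ := gradient_eq_neg_smul_of_neg_on_ball hR hynorm
      (hf.differentiable (by simp) y₀) (by rw [hfront] at hyfront; exact hyfront)
      (fun x hx => by have := (hballU hx).1; rw [hΩf] at this; exact this) hgne
    have hzero := hbd' y₀ hyfront
    rw [hνy, map_smul, hceq, map_smul, smul_eq_mul, smul_eq_mul] at hzero
    have hpos : 0 < ‖c • (x₀ - y₀)‖⁻¹ := by
      rw [← hceq]
      positivity
    exact (mul_neg_of_pos_of_neg hpos (mul_neg_of_neg_of_pos hc hopf)).ne hzero
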